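/- arXiv:2106.14398 — 3 statements merged into one kernel-verified Lean document; each statement's English description precedes it below -/
import Mathlib

section
/- In an ado-semilattice (S,⊔,∩), if a and b have a common upper bound (there is c with a ≤ c and b ≤ c, where x ≤ y means x = x∩y) and d ≲ a and d ≲ b, then d ≲ a∩b (where x ≲ y means y⊔x = y). -/
/-- An ado-semilattice: `(S,∩)` is a meet-semilattice; with `x ≤ y` meaning
`x∩y = x`, the four o-semilattice laws hold; `⊔` is associative; and the
distributivity law holds. -/
structure IsAdo {S : Type*} (inter ov : S → S → S) : Prop where
  inter_comm : ∀ a b, inter a b = inter b a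
  inter_assoc : ∀ a b c, inter (inter a b) c = inter a (inter b c)
  inter_idem : ∀ a, inter a a = a
  le1 : ∀ x y, inter x (ov x y) = x
  le2 : ∀ x y z, inter (ov (inter x y) (inter y z)) y = ov (inter x y) (inter y z)
  le3 : ∀ x y, inter (ov x y) (ov x (inter y (ov x y))) = ov x y
  le4 : ∀ x y z, inter (inter x z) (ov (inter x y) z) = inter x z
  ov_assoc : ∀ x y z, ov (ov x y) z = ov x (ov y z)
  distrib : ∀ a b c d,
    ov (inter a d) (inter (inter b d) (inter c d)) =
      inter (ov (inter a d) (inter b d)) (ov (inter a d) (inter c d))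

namespace IsAdo

variable {S : Type*} {inter ov : S → S → S}

theorem le_trans (h : IsAdo inter ov) {x y z : S} (hxy : inter x y = x) (hyz : inter y z = y) :
    inter x z = x := by
  rw [← hxy, h.inter_assoc, hyz]

theorem le_antisymm (h : IsAdo inter ov) {x y : S} (hxy : inter x y = x) (hyx : inter y x = y) :
    x = y := by
  rw [← hxy, h.inter_comm, hyx]

theorem inter_le_left (h : IsAdo inter ov) (x y : S) : inter (inter x y) x = inter x y := by
  rw [h.inter_comm, ← h.inter_assoc, h.inter_idem]

theorem inter_le_right (h : IsAdo inter ov) (x y : S) : inter (inter x y) y = inter x y := by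
  rw [h.inter_assoc, h.inter_idem]

theorem le_inter (h : IsAdo inter ov) {x y z : S} (hy : inter x y = x) (hz : inter x z = x) :
    inter x (inter y z) = x := by
  rw [← h.inter_assoc, hy, hz]

theorem ov_le (h : IsAdo inter ov) {x y z : S} (hx : inter x z = x) (hy : inter y z = y) :
    inter (ov x y) z = ov x y := by
  have := h.le2 x z y
  rwa [hx, h.inter_comm z y, hy] at this

theorem le_ov_right (h : IsAdo inter ov) {x y z : S} (hx : inter x z = x) (hy : inter y z = y) :
    inter y (ov x y) = y := by
  have := h.le4 z x y
  rwa [h.inter_comm z y, hy, h.inter_comm z x, hx] at this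

theorem ov_comm_of_le (h : IsAdo inter ov) {x y z : S} (hx : inter x z = x)
    (hy : inter y z = y) : ov x y = ov y x :=
  h.le_antisymm (h.ov_le (h.le_ov_right hy hx) (h.le1 y x))
    (h.ov_le (h.le_ov_right hx hy) (h.le1 x y))

theorem ov_eq_left (h : IsAdo inter ov) {x y : S} (hy : inter y x = y) : ov x y = x :=
  h.le_antisymm (h.ov_le (h.inter_idem x) hy) (h.le1 x y)

theorem ov_inter_ov (h : IsAdo inter ov) (x y : S) : ov x (inter y (ov x y)) = ov x y :=
  h.le_antisymm (h.ov_le (h.le1 x y) (h.inter_le_right y _)) (h.le3 x y)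

theorem ov_inter_of_le (h : IsAdo inter ov) {x y z w : S} (hx : inter x w = x)
    (hy : inter y w = y) (hz : inter z w = z) :
    ov x (inter y z) = inter (ov x y) (ov x z) := by
  have := h.distrib x y z w
  rwa [hx, hy, hz] at this

/-- If `a` and `b` have a common upper bound, then an element above `a ∩ b` that is `≲` both
`a` and `b` lies below `a`. -/
theorem le_of_inter_le (h : IsAdo inter ov) {a b c e : S} (hac : inter a c = a)
    (hbc : inter b c = b) (hm : inter (inter a b) e = inter a b) (hae : ov a e = a)
    (hbe : ov b e = b) : inter e a = e := by
  have hpa := h.inter_le_left a (ov e a)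
  have hpe := h.inter_le_right a (ov e a)
  have hep := h.ov_inter_ov e a
  have hmp := h.le_inter (h.inter_le_left a b) (h.le_trans hm (h.le1 e a))
  generalize inter a (ov e a) = p at hpa hpe hep hmp
  have hpc := h.le_trans hpa hac
  have hba : ov b a = ov b p := by
    rw [← hbe, h.ov_assoc, h.ov_assoc, hep]
  have hle : inter a (ov p b) = a := by
    rw [h.ov_comm_of_le hpc hbc, ← hba]
    exact h.le_ov_right hbc hac
  have hp : p = a := by
    have := h.ov_inter_of_le hpc hac hbc
    rwa [h.ov_eq_left hmp, h.ov_comm_of_le hpa (h.inter_idem a), h.ov_eq_left hpa, hle] at this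
  rw [hp] at hpe
  have := h.le_ov_right hpe (h.le1 e a)
  rwa [hae] at this

end IsAdo

/-- In an ado-semilattice, if `a,b` have a common upper bound
(`x ≤ y` meaning `x = x∩y`) and `d ≲ a`, `d ≲ b` (`x ≲ y` meaning `y⊔x = y`),
then `d ≲ a∩b`. -/
theorem stmt_8 {S : Type*} (inter ov : S → S → S) (h : IsAdo inter ov) :
    ∀ a b d, (∃ c, inter a c = a ∧ inter b c = b) →
      ov a d = a → ov b d = b → ov (inter a b) d = inter a b := by
  rintro a b d ⟨c, hac, hbc⟩ had hbd
  have hm := h.le1 (inter a b) d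
  have hae : ov a (ov (inter a b) d) = a := by
    rw [← h.ov_assoc, h.ov_eq_left (h.inter_le_left a b), had]
  have hbe : ov b (ov (inter a b) d) = b := by
    rw [← h.ov_assoc, h.ov_eq_left (h.inter_le_right a b), hbd]
  have hea := h.le_of_inter_le hac hbc hm hae hbe
  have heb := h.le_of_inter_le hbc hac (by rwa [h.inter_comm b a]) hbe hae
  exact h.le_antisymm (h.le_inter hea heb) hm
end

section
/- The class of ⋎-algebras is not closed under homomorphic images: there exist a finite ⋎-algebra (S,⋎), a finite set T with a binary operation ⋎', and a surjective map φ : S → T satisfying φ(a⋎b) = φ(a)⋎'φ(b) for all a, b ∈ S, such that (T,⋎') is not a ⋎-algebra (it fails the defining quasiequation). Hence the class of ⋎-algebras is a proper quasivariety, not a variety. -/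
/-- The derived override operation `a ⊔ b := a ⋎ (a ⋎ b)` of a `⋎`-operation. -/
def vsup {S : Type*} (v : S → S → S) (a b : S) : S := v a (v a b)

/-- A `⋎`-algebra: `⋎` is commutative and idempotent; the derived operation
`a⊔b := a⋎(a⋎b)` makes `S` a left regular band; `(a⋎b)⊔(a⊔b) = a⊔b`;
`a⊔(b⋎c) = (a⊔b)⋎(a⊔c)`; and, writing `d ≲ a` for `a⊔d = a`, the
quasiequation `d ≲ a, d ≲ b, d ≲ c, d ≲ a⋎b, d ≲ b⋎c ⟹ d ≲ a⋎c` holds. -/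
structure IsVeeAlgebra {S : Type*} (v : S → S → S) : Prop where
  comm : ∀ a b, v a b = v b a
  idem : ∀ a, v a a = a
  sup_assoc : ∀ a b c, vsup v a (vsup v b c) = vsup v (vsup v a b) c
  sup_idem : ∀ a, vsup v a a = a
  sup_lrb : ∀ a b, vsup v a b = vsup v (vsup v a b) a
  absorb : ∀ a b, vsup v (v a b) (vsup v a b) = vsup v a b
  distrib : ∀ a b c, vsup v a (v b c) = v (vsup v a b) (vsup v a c)
  quasi : ∀ a b c d, vsup v a d = a → vsup v b d = b → vsup v c d = c →
    vsup v (v a b) d = v a b → vsup v (v b c) d = v b c →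
    vsup v (v a c) d = v a c

/-- Partial functions on a point: two values combine to the one that is defined, if only one is,
and otherwise to their common value when they agree and to `none` when they do not. -/
def flatVee {α : Type*} [DecidableEq α] : Option α → Option α → Option α
  | none, y => y
  | some x, none => some x
  | some x, some y => if x = y then some x else none

theorem isVeeAlgebra_flatVee {α : Type*} [DecidableEq α] :
    IsVeeAlgebra (flatVee : Option α → Option α → Option α) := by
  constructor <;> rintro (_ | a) <;> try rintro (_ | b)
  all_goals try rintro (_ | c)
  all_goals try rintro (_ | d)
  all_goals grind [flatVee, vsup]

/-- The componentwise operation on a product. -/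
def prodVee {S T : Type*} (v : S → S → S) (w : T → T → T) (p q : S × T) : S × T :=
  (v p.1 q.1, w p.2 q.2)

theorem vsup_prodVee {S T : Type*} (v : S → S → S) (w : T → T → T) (p q : S × T) :
    vsup (prodVee v w) p q = (vsup v p.1 q.1, vsup w p.2 q.2) := rfl

theorem IsVeeAlgebra.prod {S T : Type*} {v : S → S → S} {w : T → T → T}
    (hv : IsVeeAlgebra v) (hw : IsVeeAlgebra w) : IsVeeAlgebra (prodVee v w) where
  comm _ _ := Prod.ext (hv.comm _ _) (hw.comm _ _)
  idem _ := Prod.ext (hv.idem _) (hw.idem _)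
  sup_assoc _ _ _ := Prod.ext (hv.sup_assoc _ _ _) (hw.sup_assoc _ _ _)
  sup_idem _ := Prod.ext (hv.sup_idem _) (hw.sup_idem _)
  sup_lrb _ _ := Prod.ext (hv.sup_lrb _ _) (hw.sup_lrb _ _)
  absorb _ _ := Prod.ext (hv.absorb _ _) (hw.absorb _ _)
  distrib _ _ _ := Prod.ext (hv.distrib _ _ _) (hw.distrib _ _ _)
  quasi a b c d h₁ h₂ h₃ h₄ h₅ := by
    simp only [vsup_prodVee, prodVee, Prod.ext_iff] at *
    exact ⟨hv.quasi _ _ _ _ h₁.1 h₂.1 h₃.1 h₄.1 h₅.1, hw.quasi _ _ _ _ h₁.2 h₂.2 h₃.2 h₄.2 h₅.2⟩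

/-- The operation obtained by adjoining an absorbing element `none`. -/
def absorbingVee {S : Type*} (v : S → S → S) : Option S → Option S → Option S :=
  Option.map₂ v

/-- The map collapsing all pairs whose first component is defined to the absorbing element. -/
def collapse {S : Type*} (p : Option Unit × S) : Option S :=
  if p.1.isSome then none else some p.2

theorem collapse_surjective {S : Type*} [Nonempty S] :
    Function.Surjective (collapse : Option Unit × S → Option S)
  | none => ⟨(some (), Classical.arbitrary S), rfl⟩
  | some x => ⟨(none, x), rfl⟩

/-- The class of `⋎`-algebras is not closed under homomorphic
images: there are a finite `⋎`-algebra `(S,⋎)`, a finite set `T` with a binary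
operation `⋎'`, and a surjective homomorphism `φ : S → T` such that `(T,⋎')`
fails the defining quasiequation, hence is not a `⋎`-algebra.  So the class of
`⋎`-algebras is a proper quasivariety, not a variety. -/
theorem stmt_13 :
    ∃ (S T : Type) (_ : Fintype S) (_ : Fintype T) (v : S → S → S)
      (v' : T → T → T) (φ : S → T),
      IsVeeAlgebra v ∧
      Function.Surjective φ ∧
      (∀ a b, φ (v a b) = v' (φ a) (φ b)) ∧
      (∃ a b c d, vsup v' a d = a ∧ vsup v' b d = b ∧ vsup v' c d = c ∧
        vsup v' (v' a b) d = v' a b ∧ vsup v' (v' b c) d = v' b c ∧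
        vsup v' (v' a c) d ≠ v' a c) ∧
      ¬ IsVeeAlgebra v' := by
  have hquasi : ∃ a b c d : Option (Option Bool),
      let v' := absorbingVee (flatVee (α := Bool))
      vsup v' a d = a ∧ vsup v' b d = b ∧ vsup v' c d = c ∧
        vsup v' (v' a b) d = v' a b ∧ vsup v' (v' b c) d = v' b c ∧
        vsup v' (v' a c) d ≠ v' a c :=
    ⟨some (some false), none, some (some true), some (some false), by decide⟩
  refine ⟨Option Unit × Option Bool, Option (Option Bool), inferInstance, inferInstance,
    prodVee flatVee flatVee, absorbingVee flatVee, collapse,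
    isVeeAlgebra_flatVee.prod isVeeAlgebra_flatVee, collapse_surjective, by decide, hquasi, ?_⟩
  intro h
  obtain ⟨a, b, c, d, h₁, h₂, h₃, h₄, h₅, hne⟩ := hquasi
  exact hne (h.quasi a b c d h₁ h₂ h₃ h₄ h₅)
end

section
/- An algebra (S,⊔,∖) is an od-algebra if and only if there exist sets X and Y and an injective map φ : S → Par(X,Y) such that φ(a⊔b) = φ(a)⊔φ(b) and φ(a∖b) = φ(a)∖φ(b) for all a, b ∈ S, where on Par(X,Y) the operation ⊔ is override and ∖ is set-theoretic difference of graphs. Hence the variety of od-algebras axiomatises the functional algebras of signature (⊔,∖). -/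
universe u

/- Partial functions from `X` to `Y` are modelled as maps `X → Option Y`
(equivalently, single-valued subsets of `X × Y`). -/

/-- Override: `f ⊔ g` agrees with `f` on `dom f` and with `g` on
`dom g \ dom f`. -/
def pOv {X Y : Type*} (f g : X → Option Y) : X → Option Y :=
  fun x => (f x).or (g x)

open Classical in
/-- Intersection of graphs. -/
noncomputable def pInt {X Y : Type*} (f g : X → Option Y) : X → Option Y :=
  fun x => if f x = g x then f x else none

open Classical in
/-- Restricted union: the restriction of the relation `f ∪ g` to the points
where it is single-valued. -/
noncomputable def pRU {X Y : Type*} (f g : X → Option Y) : X → Option Y :=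
  fun x =>
    if f x = none then g x
    else if g x = none then f x
    else if f x = g x then f x else none

open Classical in
/-- Set-theoretic difference of graphs of partial functions. -/
noncomputable def pDiff {X Y : Type*} (f g : X → Option Y) : X → Option Y :=
  fun x => if f x = g x then none else f x

/-- An od-algebra (override-difference algebra): with `a∩b := a∖(a∖b)`,
`(S,⊔,∩)` is an ado-semilattice, `(a∖b)∩b` takes a constant value `0` for all
`a,b`, and `(a∖b)⊔(a∩b) = a`. -/
structure IsOd {S : Type*} (ov diff : S → S → S) : Prop where
  ado : IsAdo (fun a b => diff a (diff a b)) ov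
  const : ∀ a b c d,
    diff (diff a b) (diff (diff a b) b) = diff (diff c d) (diff (diff c d) d)
  recover : ∀ a b, ov (diff a b) (diff a (diff a b)) = a

/-- An od-algebra whose meet, override, difference and zero are written with the
lattice notation, and whose laws are stated in terms of the order. The operation `⊔`
is override, and not in general a least upper bound. -/
class OdAlgebra (S : Type*) extends SemilatticeInf S, Max S, SDiff S, Bot S where
  le_ov : ∀ x y : S, x ≤ x ⊔ y
  ov_le : ∀ {x y z : S}, x ≤ z → y ≤ z → x ⊔ y ≤ z
  ov_le_ov_inf : ∀ x y : S, x ⊔ y ≤ x ⊔ (y ⊓ (x ⊔ y))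
  inf_le_ov : ∀ x y z : S, x ⊓ z ≤ (x ⊓ y) ⊔ z
  ov_assoc : ∀ x y z : S, x ⊔ y ⊔ z = x ⊔ (y ⊔ z)
  ov_inf : ∀ {a b c d : S}, a ≤ d → b ≤ d → c ≤ d → a ⊔ (b ⊓ c) = (a ⊔ b) ⊓ (a ⊔ c)
  sdiff_inf : ∀ a b : S, a \ b ⊓ b = ⊥
  sdiff_ov_inf : ∀ a b : S, (a \ b) ⊔ (a ⊓ b) = a

namespace OdAlgebra

variable {S : Type*} [OdAlgebra S] {a b c d p q r s u v x y z : S}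

theorem zero_le (x : S) : ⊥ ≤ x := sdiff_inf x x ▸ inf_le_right

theorem eq_zero_of_le (h : x ≤ ⊥) : x = ⊥ := le_antisymm h (zero_le x)

theorem sdiff_le (a b : S) : a \ b ≤ a := by
  conv_rhs => rw [← sdiff_ov_inf a b]
  exact le_ov _ _

theorem le_ov_right (hx : x ≤ d) (hy : y ≤ d) : y ≤ x ⊔ y := by
  simpa [inf_eq_right.2 hx, inf_eq_right.2 hy] using inf_le_ov d x y

theorem ov_comm_of_le (hx : x ≤ d) (hy : y ≤ d) : x ⊔ y = y ⊔ x :=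
  le_antisymm (ov_le (le_ov_right hy hx) (le_ov _ _)) (ov_le (le_ov_right hx hy) (le_ov _ _))

theorem ov_eq_left (h : x ≤ y) : y ⊔ x = y :=
  le_antisymm (ov_le le_rfl h) (le_ov _ _)

theorem zero_ov (x : S) : ⊥ ⊔ x = x :=
  (ov_comm_of_le (zero_le x) le_rfl).trans (ov_eq_left (zero_le x))

theorem sdiff_ov (h : b ≤ a) : (a \ b) ⊔ b = a := by
  simpa [inf_eq_right.2 h] using sdiff_ov_inf a b

theorem ov_mono_right (a : S) (h : x ≤ y) : a ⊔ x ≤ a ⊔ y := by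
  refine (ov_le_ov_inf a x).trans (ov_le (le_ov _ _) ?_)
  have h4 := inf_le_ov (a ⊔ x) a y
  rw [inf_eq_right.2 (le_ov a x)] at h4
  exact (le_inf inf_le_right (inf_le_left.trans h)).trans h4

theorem le_of_inf_eq_zero (hy : y ≤ d) (hs : s ≤ d) (h : z ≤ y ⊔ s) (h0 : z ⊓ s = ⊥) :
    z ≤ y := by
  have hz : z ≤ d := h.trans (ov_le hy hs)
  have := ov_inf hy hz hs
  rw [h0, ov_eq_left (zero_le y)] at this
  rw [this]
  exact le_inf (le_ov_right hy hz) h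

theorem ov_sdiff_le (s p : S) : (s ⊔ p) \ s ≤ p := by
  have hg : p ⊓ (s ⊔ p) ≤ s ⊔ p := inf_le_right
  refine (le_of_inf_eq_zero hg (le_ov s p) ?_ (sdiff_inf _ _)).trans inf_le_left
  rw [ov_comm_of_le hg (le_ov s p)]
  exact (sdiff_le _ _).trans (ov_le_ov_inf s p)

/-- `DomLE x y` says that the domain of `x` is contained in the domain of `y`. -/
def DomLE (x y : S) : Prop := y ⊔ x = y

theorem DomLE.of_le (h : x ≤ y) : DomLE x y := ov_eq_left h

theorem DomLE.trans (h : DomLE x y) (h' : DomLE y z) : DomLE x z := by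
  unfold DomLE at *
  rw [← h', ov_assoc, h]

theorem DomLE.ov (h : DomLE x z) (h' : DomLE y z) : DomLE (x ⊔ y) z := by
  unfold DomLE at *
  rw [← ov_assoc, h, h']

theorem domLE_ov_left (x y : S) : DomLE x (x ⊔ y) := .of_le (le_ov x y)

theorem domLE_ov_right (x y : S) : DomLE y (x ⊔ y) := by
  unfold DomLE
  rw [ov_assoc, ov_eq_left le_rfl]

theorem DomLE.ov_mono (h : DomLE x z) (a : S) : DomLE (x ⊔ a) (z ⊔ a) :=
  .ov (h.trans (domLE_ov_left _ _)) (domLE_ov_right _ _)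

/-- The restriction of `p` to the domain of `s`. -/
theorem exists_restriction (h : DomLE s p) : ∃ r ≤ p, DomLE s r ∧ DomLE r s := by
  set y := (s ⊔ p) \ s with hy
  have hyp : y ≤ p := ov_sdiff_le s p
  have hys : y ≤ s ⊔ p := sdiff_le _ _
  have hyov : y ⊔ s = s ⊔ p := sdiff_ov (le_ov s p)
  set r := p \ y with hr
  have hrp : r ≤ p := sdiff_le _ _
  have hrov : r ⊔ y = p := sdiff_ov hyp
  refine ⟨r, hrp, ?_, ?_⟩
  · set z := (r ⊔ s) \ r with hz
    have hzs : z ≤ s := ov_sdiff_le r s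
    have hzr : z ≤ r ⊔ s := sdiff_le _ _
    have hzp : r ⊔ z ⊔ y = p := by
      rw [ov_assoc, ov_comm_of_le (hzs.trans (le_ov s p)) hys, ← ov_assoc, hrov]
      exact (DomLE.of_le hzs).trans h
    have hzp' : z ≤ y ⊔ r := by
      rw [ov_comm_of_le hyp hrp, hrov, ← hzp]
      exact (le_ov_right (le_ov r s) hzr).trans (le_ov _ _)
    have hzy : z ≤ y := le_of_inf_eq_zero hyp hrp hzp' (sdiff_inf _ _)
    have hz0 : z = ⊥ := eq_zero_of_le (sdiff_inf (s ⊔ p) s ▸ le_inf hzy hzs)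
    have := sdiff_ov (le_ov r s)
    rw [← hz, hz0, zero_ov] at this
    exact this.symm
  · set z := (s ⊔ r) \ s with hz
    have hzr : z ≤ r := ov_sdiff_le s r
    have hzp : z ≤ s ⊔ p := (sdiff_le _ _).trans (ov_mono_right s hrp)
    have hzy : z ≤ y :=
      le_of_inf_eq_zero hys (le_ov s p) (hyov.symm ▸ hzp) (sdiff_inf _ _)
    have hz0 : z = ⊥ := eq_zero_of_le (sdiff_inf p y ▸ le_inf hzr hzy)
    have := sdiff_ov (le_ov s r)
    rw [← hz, hz0, zero_ov] at this
    exact this.symm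

theorem DomLE.inf (hp : p ≤ d) (hq : q ≤ d) (hsp : DomLE s p) (hsq : DomLE s q) :
    DomLE s (p ⊓ q) := by
  obtain ⟨r, hrp, hsr, hrs⟩ := exists_restriction hsp
  obtain ⟨t, htq, hst, hts⟩ := exists_restriction hsq
  have hrt : r = t := by
    have h₁ : r ⊔ t = r := hts.trans hsr
    have h₂ : t ⊔ r = t := hrs.trans hst
    rw [← h₁, ov_comm_of_le (hrp.trans hp) (htq.trans hq), h₂]
  exact hsr.trans (.of_le (le_inf hrp (hrt ▸ htq)))

/-- Sets closed under override and downwards in the domain preorder. -/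
structure IsDomIdeal (I : Set S) : Prop where
  zero_mem : ⊥ ∈ I
  ov_mem : ∀ {x y}, x ∈ I → y ∈ I → x ⊔ y ∈ I
  mem_of_domLE : ∀ {x y}, DomLE x y → y ∈ I → x ∈ I

/-- Domain ideals whose complement is closed under meets of elements bounded above. -/
structure IsPrimeDomIdeal (I : Set S) : Prop extends IsDomIdeal I where
  inf_notMem : ∀ {u v b}, u ≤ b → v ≤ b → u ∉ I → v ∉ I → u ⊓ v ∉ I

theorem IsDomIdeal.adjoin {I : Set S} (hI : IsDomIdeal I) (a : S) :
    IsDomIdeal {c | ∃ i ∈ I, DomLE c (i ⊔ a)} where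
  zero_mem := ⟨⊥, hI.zero_mem, .of_le (zero_le _)⟩
  ov_mem := by
    rintro x y ⟨i, hi, hx⟩ ⟨j, hj, hy⟩
    exact ⟨i ⊔ j, hI.ov_mem hi hj, .ov (hx.trans ((domLE_ov_left i j).ov_mono a))
      (hy.trans ((domLE_ov_right i j).ov_mono a))⟩
  mem_of_domLE := by
    rintro x y hxy ⟨i, hi, hy⟩
    exact ⟨i, hi, hxy.trans hy⟩

theorem domLE_ov_inf {k : S} (hu : u ≤ b) (hv : v ≤ b) (hsu : DomLE s (k ⊔ u))
    (hsv : DomLE s (k ⊔ v)) : DomLE s (k ⊔ (u ⊓ v)) := by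
  have aux : ∀ {w}, w ≤ b → k ⊔ w ≤ k ⊔ (w ⊓ (k ⊔ b)) := fun {w} hw =>
    (ov_le_ov_inf k w).trans (ov_mono_right k (inf_le_inf_left w (ov_mono_right k hw)))
  have h := DomLE.inf (ov_le (le_ov k b) inf_le_right) (ov_le (le_ov k b) inf_le_right)
    (hsu.trans (.of_le (aux hu))) (hsv.trans (.of_le (aux hv)))
  rw [← ov_inf (le_ov k b) inf_le_right inf_le_right] at h
  exact h.trans (.of_le (ov_mono_right k (inf_le_inf inf_le_left inf_le_left)))

theorem exists_isPrimeDomIdeal (hs : s ≠ ⊥) : ∃ I : Set S, IsPrimeDomIdeal I ∧ s ∉ I := by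
  obtain ⟨I, hI⟩ := zorn_subset {I : Set S | IsDomIdeal I ∧ s ∉ I} (by
    intro C hC hchain
    rcases C.eq_empty_or_nonempty with rfl | ⟨J, hJ⟩
    · refine ⟨{⊥}, ⟨⟨rfl, ?_, ?_⟩, hs⟩, by simp⟩
      · rintro x y rfl rfl
        exact zero_ov _
      · rintro x y h rfl
        exact (zero_ov x).symm.trans h
    · refine ⟨⋃₀ C, ⟨⟨⟨J, hJ, (hC hJ).1.zero_mem⟩, ?_, ?_⟩, ?_⟩,
        fun K hK => Set.subset_sUnion_of_mem hK⟩
      · rintro x y ⟨K, hK, hx⟩ ⟨L, hL, hy⟩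
        rcases hchain.total hK hL with h | h
        · exact ⟨L, hL, (hC hL).1.ov_mem (h hx) hy⟩
        · exact ⟨K, hK, (hC hK).1.ov_mem hx (h hy)⟩
      · rintro x y h ⟨K, hK, hy⟩
        exact ⟨K, hK, (hC hK).1.mem_of_domLE h hy⟩
      · rintro ⟨K, hK, hsK⟩
        exact (hC hK).2 hsK)
  obtain ⟨hId, hsI⟩ := hI.prop
  have key : ∀ {a}, a ∉ I → ∃ i ∈ I, DomLE s (i ⊔ a) := by
    intro a ha
    by_contra hc
    refine ha (hI.le_of_ge ⟨hId.adjoin a, hc⟩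
      (fun i hi => ⟨i, hi, domLE_ov_left i a⟩) ⟨⊥, hId.zero_mem, domLE_ov_right _ _⟩)
  refine ⟨I, ⟨hId, fun {u v b} hu hv huI hvI huv => hsI ?_⟩, hsI⟩
  obtain ⟨i, hi, hsu⟩ := key huI
  obtain ⟨j, hj, hsv⟩ := key hvI
  have hk := hId.ov_mem hi hj
  exact hId.mem_of_domLE
    (domLE_ov_inf hu hv (hsu.trans ((domLE_ov_left i j).ov_mono u))
      (hsv.trans ((domLE_ov_right i j).ov_mono v))) (hId.ov_mem hk huv)

namespace IsPrimeDomIdeal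

variable {I : Set S}

theorem mem_of_le (hI : IsPrimeDomIdeal I) (h : x ≤ y) (hy : y ∈ I) : x ∈ I :=
  hI.mem_of_domLE (.of_le h) hy

theorem inf_notMem_trans (hI : IsPrimeDomIdeal I) (hab : a ⊓ b ∉ I) (hbc : b ⊓ c ∉ I) :
    a ⊓ c ∉ I := fun h =>
  hI.inf_notMem inf_le_right inf_le_left hab hbc
    (hI.mem_of_le (inf_le_inf inf_le_left inf_le_right) h)

theorem setOf_inf_notMem_eq (hI : IsPrimeDomIdeal I) (h : a ⊓ b ∉ I) :
    {c | a ⊓ c ∉ I} = {c | b ⊓ c ∉ I} :=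
  Set.ext fun _ => ⟨hI.inf_notMem_trans (inf_comm a b ▸ h), hI.inf_notMem_trans h⟩

theorem inf_notMem_of_mem_left (hI : IsPrimeDomIdeal I) (ha : a ∈ I) (hb : b ∉ I) :
    (a ⊔ b) ⊓ b ∉ I := fun h => hb <| by
  rw [inf_comm] at h
  exact hI.mem_of_domLE ((domLE_ov_right a b).trans (.of_le (ov_le_ov_inf a b)))
    (hI.ov_mem ha h)

theorem sdiff_mem_iff (hI : IsPrimeDomIdeal I) (ha : a ∉ I) : a \ b ∈ I ↔ a ⊓ b ∉ I := by
  refine ⟨fun h h' => ha ?_, fun h => by_contra fun h' => ?_⟩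
  · rw [← sdiff_ov_inf a b]
    exact hI.ov_mem h h'
  · refine hI.inf_notMem (sdiff_le a b) inf_le_left h' h (hI.mem_of_le ?_ hI.zero_mem)
    rw [← sdiff_inf a b]
    exact inf_le_inf_left _ inf_le_right

end IsPrimeDomIdeal

open Classical in
/-- The partial function represented by `a`: at a prime domain ideal `I` not containing `a`,
its value is the set of all elements that agree with `a` at `I`. -/
noncomputable def toPartial (a : S) (I : {I : Set S // IsPrimeDomIdeal I}) : Option (Set S) :=
  if a ∈ I.1 then none else some {c | a ⊓ c ∉ I.1}

theorem toPartial_eq_none {I : {I : Set S // IsPrimeDomIdeal I}} (h : a ∈ I.1) :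
    toPartial a I = none := if_pos h

theorem toPartial_eq_some {I : {I : Set S // IsPrimeDomIdeal I}} (h : a ∉ I.1) :
    toPartial a I = some {c | a ⊓ c ∉ I.1} := if_neg h

theorem toPartial_congr {I : {I : Set S // IsPrimeDomIdeal I}} (h : a ⊓ b ∉ I.1) :
    toPartial a I = toPartial b I := by
  rw [toPartial_eq_some fun ha => h (I.2.mem_of_le inf_le_left ha),
    toPartial_eq_some fun hb => h (I.2.mem_of_le inf_le_right hb), I.2.setOf_inf_notMem_eq h]

theorem toPartial_eq_iff {I : {I : Set S // IsPrimeDomIdeal I}} (ha : a ∉ I.1) :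
    toPartial a I = toPartial b I ↔ a ⊓ b ∉ I.1 := by
  refine ⟨fun h => ?_, toPartial_congr⟩
  by_cases hb : b ∈ I.1
  · rw [toPartial_eq_some ha, toPartial_eq_none hb] at h
    cases h
  · rw [toPartial_eq_some ha, toPartial_eq_some hb, Option.some_inj] at h
    have hb' : b ∈ {c | b ⊓ c ∉ I.1} := by simpa using hb
    rwa [← h] at hb'

theorem toPartial_ov (a b : S) : toPartial (a ⊔ b) = pOv (toPartial a) (toPartial b) := by
  funext I
  unfold pOv
  by_cases ha : a ∈ I.1
  · rw [toPartial_eq_none ha, Option.none_or]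
    by_cases hb : b ∈ I.1
    · rw [toPartial_eq_none hb, toPartial_eq_none (I.2.ov_mem ha hb)]
    · exact toPartial_congr (I.2.inf_notMem_of_mem_left ha hb)
  · rw [toPartial_congr (a := a ⊔ b) (b := a) (by rwa [inf_eq_right.2 (le_ov a b)]),
      toPartial_eq_some ha, Option.some_or]

theorem toPartial_sdiff (a b : S) : toPartial (a \ b) = pDiff (toPartial a) (toPartial b) := by
  funext I
  unfold pDiff
  by_cases ha : a ∈ I.1
  · rw [toPartial_eq_none (I.2.mem_of_le (sdiff_le a b) ha), toPartial_eq_none ha, ite_self]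
  · split_ifs with h
    · exact toPartial_eq_none ((I.2.sdiff_mem_iff ha).2 ((toPartial_eq_iff ha).1 h))
    · rw [toPartial_eq_iff ha] at h
      refine toPartial_congr ?_
      rw [inf_eq_left.2 (sdiff_le a b), I.2.sdiff_mem_iff ha]
      exact h

theorem le_of_toPartial_eq (h : toPartial a = toPartial b) : a ≤ b := by
  by_cases h0 : a \ b = ⊥
  · have := sdiff_ov_inf a b
    rw [h0, zero_ov] at this
    exact inf_eq_left.1 this
  · obtain ⟨I, hI, hs⟩ := exists_isPrimeDomIdeal h0
    have ha : a ∉ I := fun ha => hs (hI.mem_of_le (sdiff_le a b) ha)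
    exact absurd ((hI.sdiff_mem_iff ha).2
      ((toPartial_eq_iff (I := ⟨I, hI⟩) ha).1 (congrFun h _))) hs

theorem toPartial_injective :
    Function.Injective (toPartial : S → {I : Set S // IsPrimeDomIdeal I} → Option (Set S)) :=
  fun _ _ h => le_antisymm (le_of_toPartial_eq h) (le_of_toPartial_eq h.symm)

/-- An algebra satisfying `IsOd` as an `OdAlgebra`, with zero `(e ∖ e) ∩ e`. -/
abbrev ofIsOd {S : Type*} {ov diff : S → S → S} (h : IsOd ov diff) (e : S) : OdAlgebra S where
  inf a b := diff a (diff a b)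
  le a b := diff a (diff a b) = a
  le_refl := h.ado.inter_idem
  le_trans a b c hab hbc := by
    have := h.ado.inter_assoc a b c
    simp only [hab, hbc] at this
    exact this
  le_antisymm a b hab hba := by
    have := h.ado.inter_comm a b
    simp only [hab, hba] at this
    exact this
  inf_le_left a b := by
    have := h.ado.inter_assoc a a b
    have h' := h.ado.inter_idem a
    have hc := h.ado.inter_comm (diff a (diff a b)) a
    simp only [h'] at this hc
    exact hc.trans this.symm
  inf_le_right a b := by
    have := h.ado.inter_assoc a b b
    have h' := h.ado.inter_idem b
    simp only [h'] at this
    exact this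
  le_inf a b c hab hac := by
    have := h.ado.inter_assoc a b c
    simp only [hab, hac] at this
    exact this.symm
  max := ov
  sdiff := diff
  bot := diff (diff e e) (diff (diff e e) e)
  le_ov := h.ado.le1
  ov_le {x y z} hx hy := by
    have := h.ado.le2 x z y
    have hc := h.ado.inter_comm y z
    simp only [hx, hy] at this hc
    rw [← hc] at this
    exact this
  ov_le_ov_inf := h.ado.le3
  inf_le_ov := h.ado.le4
  ov_assoc := h.ado.ov_assoc
  ov_inf {a b c d} ha hb hc := by
    have := h.ado.distrib a b c d
    simp only [ha, hb, hc] at this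
    exact this
  sdiff_inf a b := h.const a b e e
  sdiff_ov_inf := h.recover

end OdAlgebra

open Classical in
theorem option_or_eq_ite {α : Type*} (a b : Option α) :
    a.or b = if a = none then b else a := by
  cases a <;> simp

theorem pDiff_pDiff {X Y : Type*} (f g : X → Option Y) : pDiff f (pDiff f g) = pInt f g := by
  funext x
  simp only [pDiff, pInt]
  grind

theorem isAdo_pInt_pOv {X Y : Type*} : IsAdo (pInt (X := X) (Y := Y)) pOv := by
  constructor <;> intros <;> funext x <;> simp only [pInt, pOv] <;>
    grind [option_or_eq_ite]

theorem isOd_pOv_pDiff {X Y : Type*} : IsOd (pOv (X := X) (Y := Y)) pDiff where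
  ado := by
    simp only [pDiff_pDiff]
    exact isAdo_pInt_pOv
  const a b c d := by
    simp only [pDiff_pDiff]
    funext x
    simp only [pInt, pDiff]
    grind
  recover a b := by
    simp only [pDiff_pDiff]
    funext x
    simp only [pInt, pDiff, pOv]
    grind [option_or_eq_ite]

theorem IsOd.of_injective {S T : Type*} {ov diff : S → S → S} {ov' diff' : T → T → T}
    (h : IsOd ov' diff') {φ : S → T} (hφ : Function.Injective φ)
    (hov : ∀ a b, φ (ov a b) = ov' (φ a) (φ b))
    (hdiff : ∀ a b, φ (diff a b) = diff' (φ a) (φ b)) : IsOd ov diff where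
  ado := by
    constructor <;> intros <;> apply hφ <;> simp only [hov, hdiff]
    exacts [h.ado.inter_comm _ _, h.ado.inter_assoc _ _ _, h.ado.inter_idem _, h.ado.le1 _ _,
      h.ado.le2 _ _ _, h.ado.le3 _ _, h.ado.le4 _ _ _, h.ado.ov_assoc _ _ _,
      h.ado.distrib _ _ _ _]
  const a b c d := hφ <| by
    simpa only [hdiff] using h.const _ _ _ _
  recover a b := hφ <| by
    simpa only [hov, hdiff] using h.recover _ _

/-- An algebra `(S,⊔,∖)` is an od-algebra iff there exist sets
`X, Y` and an injective map `φ : S → Par(X,Y)` with `φ(a⊔b) = φ(a)⊔φ(b)` and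
`φ(a∖b) = φ(a)∖φ(b)`, where on `Par(X,Y)` the operation `⊔` is override and
`∖` is set-theoretic difference of graphs.  Hence the variety of od-algebras
axiomatises the functional algebras of signature `(⊔,∖)`. -/
theorem stmt_19 {S : Type u} (ov diff : S → S → S) :
    IsOd ov diff ↔
      ∃ (X Y : Type u) (φ : S → X → Option Y),
        Function.Injective φ ∧
        (∀ a b, φ (ov a b) = pOv (φ a) (φ b)) ∧
        (∀ a b, φ (diff a b) = pDiff (φ a) (φ b)) := by
  constructor
  · intro h
    rcases isEmpty_or_nonempty S with hS | ⟨⟨e⟩⟩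
    · exact ⟨S, S, isEmptyElim, fun a => isEmptyElim a, fun a => isEmptyElim a,
        fun a => isEmptyElim a⟩
    · let _ := OdAlgebra.ofIsOd h e
      exact ⟨_, _, OdAlgebra.toPartial, OdAlgebra.toPartial_injective,
        OdAlgebra.toPartial_ov, OdAlgebra.toPartial_sdiff⟩
  · rintro ⟨X, Y, φ, hφ, hov, hdiff⟩
    exact isOd_pOv_pDiff.of_injective hφ hov hdiff
end
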